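/- Let u : ℂ → ℝ be a smooth solution of the sinh-Gordon equation ∂∂̄u + (1/2) sinh(2u) = 0, let r ∈ ℝ be a constant, and let ω : ℂ → ℝ be a smooth solution of the inhomogeneous Jacobi equation ∂̄∂ω + cosh(2u) ω = r e^{2u}. Then ∂̄(∂²ω − 2 ∂u · ∂ω) = −∂(e^{−2u} ω) holds identically on ℂ. -/

import Mathlib

noncomputable section

open Complex Matrix

/-- Wirtinger derivative `∂f = (1/2)(f_x - i f_y)`. -/
def wd (f : ℂ → ℂ) (z : ℂ) : ℂ :=
  (fderiv ℝ f z 1 - Complex.I * fderiv ℝ f z Complex.I) / 2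

/-- Conjugate Wirtinger derivative `∂̄f = (1/2)(f_x + i f_y)`. -/
def wdb (f : ℂ → ℂ) (z : ℂ) : ℂ :=
  (fderiv ℝ f z 1 + Complex.I * fderiv ℝ f z Complex.I) / 2

/-- Complexification of a real-valued function. -/
def cx (u : ℂ → ℝ) : ℂ → ℂ := fun z => (u z : ℂ)

/-- Entrywise Wirtinger derivative of a matrix-valued function. -/
def mwd (F : ℂ → Matrix (Fin 2) (Fin 2) ℂ) (z : ℂ) : Matrix (Fin 2) (Fin 2) ℂ :=
  Matrix.of fun i j => wd (fun w => F w i j) z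

/-- Entrywise conjugate Wirtinger derivative of a matrix-valued function. -/
def mwdb (F : ℂ → Matrix (Fin 2) (Fin 2) ℂ) (z : ℂ) : Matrix (Fin 2) (Fin 2) ℂ :=
  Matrix.of fun i j => wdb (fun w => F w i j) z

/-- Entrywise Wirtinger derivative of a vector-valued function. -/
def vwd (v : ℂ → Fin 2 → ℂ) (z : ℂ) : Fin 2 → ℂ := fun i => wd (fun w => v w i) z

/-- Entrywise conjugate Wirtinger derivative of a vector-valued function. -/
def vwdb (v : ℂ → Fin 2 → ℂ) (z : ℂ) : Fin 2 → ℂ := fun i => wdb (fun w => v w i) z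

/-- `u` solves the sinh-Gordon equation `∂∂̄u + (1/2) sinh (2u) = 0`. -/
def SinhGordon (u : ℂ → ℝ) : Prop :=
  ∀ z, wd (wdb (cx u)) z + (1/2) * Complex.sinh (2 * (u z : ℂ)) = 0

/-- `(ψ₁, ψ₂)` solves the system `(Ψ_λ)`. -/
def SolPsi (u : ℂ → ℝ) (lam : ℂ) (p1 p2 : ℂ → ℂ) : Prop :=
  ContDiff ℝ (⊤ : ℕ∞) p1 ∧ ContDiff ℝ (⊤ : ℕ∞) p2 ∧
  (∀ z, wd p1 z = (1/2) * (wd (cx u) z * p1 z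
      + Complex.I * Complex.exp (-(u z : ℂ)) * p2 z)) ∧
  (∀ z, wd p2 z = (1/2) * (Complex.I * lam⁻¹ * Complex.exp ((u z : ℂ)) * p1 z
      - wd (cx u) z * p2 z)) ∧
  (∀ z, wdb p1 z = (1/2) * (-(wdb (cx u) z) * p1 z
      + Complex.I * lam * Complex.exp ((u z : ℂ)) * p2 z)) ∧
  (∀ z, wdb p2 z = (1/2) * (Complex.I * Complex.exp (-(u z : ℂ)) * p1 z
      + wdb (cx u) z * p2 z))

/-- `(φ₁, φ₂)` solves the system `(Φ_λ)`. -/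
def SolPhi (u : ℂ → ℝ) (lam : ℂ) (f1 f2 : ℂ → ℂ) : Prop :=
  ContDiff ℝ (⊤ : ℕ∞) f1 ∧ ContDiff ℝ (⊤ : ℕ∞) f2 ∧
  (∀ z, wd f1 z = -(1/2) * (wd (cx u) z * f1 z
      + Complex.I * lam⁻¹ * Complex.exp ((u z : ℂ)) * f2 z)) ∧
  (∀ z, wd f2 z = -(1/2) * (Complex.I * Complex.exp (-(u z : ℂ)) * f1 z
      - wd (cx u) z * f2 z)) ∧
  (∀ z, wdb f1 z = -(1/2) * (-(wdb (cx u) z) * f1 z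
      + Complex.I * Complex.exp (-(u z : ℂ)) * f2 z)) ∧
  (∀ z, wdb f2 z = -(1/2) * (Complex.I * lam * Complex.exp ((u z : ℂ)) * f1 z
      + wdb (cx u) z * f2 z))

/-- The matrix `A_λ = (1/2) [[∂u, iλ⁻¹e^u], [ie^{-u}, -∂u]]`. -/
def matA (u : ℂ → ℝ) (lam : ℂ) (z : ℂ) : Matrix (Fin 2) (Fin 2) ℂ :=
  ((1:ℂ)/2) • !![wd (cx u) z, Complex.I * lam⁻¹ * Complex.exp ((u z : ℂ));
    Complex.I * Complex.exp (-(u z : ℂ)), -(wd (cx u) z)]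

/-- The matrix `B_λ = (1/2) [[-∂̄u, ie^{-u}], [iλe^u, ∂̄u]]`. -/
def matB (u : ℂ → ℝ) (lam : ℂ) (z : ℂ) : Matrix (Fin 2) (Fin 2) ℂ :=
  ((1:ℂ)/2) • !![-(wdb (cx u) z), Complex.I * Complex.exp (-(u z : ℂ));
    Complex.I * lam * Complex.exp ((u z : ℂ)), wdb (cx u) z]

theorem wd_sub {f g : ℂ → ℂ} {z : ℂ} (hf : DifferentiableAt ℝ f z)
    (hg : DifferentiableAt ℝ g z) : wd (fun w => f w - g w) z = wd f z - wd g z := by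
  simp only [wd, fderiv_fun_sub hf hg, _root_.sub_apply]
  ring

theorem wdb_sub {f g : ℂ → ℂ} {z : ℂ} (hf : DifferentiableAt ℝ f z)
    (hg : DifferentiableAt ℝ g z) : wdb (fun w => f w - g w) z = wdb f z - wdb g z := by
  simp only [wdb, fderiv_fun_sub hf hg, _root_.sub_apply]
  ring

theorem wd_mul {f g : ℂ → ℂ} {z : ℂ} (hf : DifferentiableAt ℝ f z)
    (hg : DifferentiableAt ℝ g z) :
    wd (fun w => f w * g w) z = wd f z * g z + f z * wd g z := by
  simp only [wd, fderiv_fun_mul hf hg, _root_.add_apply,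
    _root_.smul_apply, smul_eq_mul]
  ring

theorem wdb_mul {f g : ℂ → ℂ} {z : ℂ} (hf : DifferentiableAt ℝ f z)
    (hg : DifferentiableAt ℝ g z) :
    wdb (fun w => f w * g w) z = wdb f z * g z + f z * wdb g z := by
  simp only [wdb, fderiv_fun_mul hf hg, _root_.add_apply,
    _root_.smul_apply, smul_eq_mul]
  ring

theorem wd_const_mul (c : ℂ) {f : ℂ → ℂ} {z : ℂ} (hf : DifferentiableAt ℝ f z) :
    wd (fun w => c * f w) z = c * wd f z := by
  simp only [wd, fderiv_const_mul hf c, _root_.smul_apply, smul_eq_mul]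
  ring

theorem wdb_const_mul (c : ℂ) {f : ℂ → ℂ} {z : ℂ} (hf : DifferentiableAt ℝ f z) :
    wdb (fun w => c * f w) z = c * wdb f z := by
  simp only [wdb, fderiv_const_mul hf c, _root_.smul_apply, smul_eq_mul]
  ring

/-- Chain rule for a holomorphic outer function. -/
theorem wd_comp_of_hasDerivAt {h f : ℂ → ℂ} {h' z : ℂ} (hh : HasDerivAt h h' (f z))
    (hf : DifferentiableAt ℝ f z) : wd (fun w => h (f w)) z = h' * wd f z := by
  have key : HasFDerivAt (fun w => h (f w)) _ z :=
    (hh.hasFDerivAt.restrictScalars ℝ).comp z hf.hasFDerivAt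
  simp only [wd, key.fderiv, ContinuousLinearMap.comp_apply,
    ContinuousLinearMap.coe_restrictScalars', ContinuousLinearMap.toSpanSingleton_apply,
    smul_eq_mul]
  ring

theorem contDiff_wd {f : ℂ → ℂ} (hf : ContDiff ℝ (⊤ : ℕ∞) f) :
    ContDiff ℝ (⊤ : ℕ∞) (wd f) := by
  have h : ContDiff ℝ (⊤ : ℕ∞) (fderiv ℝ f) := hf.fderiv_right (by simp)
  unfold wd
  exact ((h.clm_apply contDiff_const).sub
    (contDiff_const.mul (h.clm_apply contDiff_const))).div_const 2

theorem contDiff_cx {u : ℂ → ℝ} (hu : ContDiff ℝ (⊤ : ℕ∞) u) :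
    ContDiff ℝ (⊤ : ℕ∞) (cx u) :=
  Complex.ofRealCLM.contDiff.comp hu

theorem wdb_wd_comm {f : ℂ → ℂ} (hf : ContDiff ℝ (⊤ : ℕ∞) f) (z : ℂ) :
    wdb (wd f) z = wd (wdb f) z := by
  have hd : DifferentiableAt ℝ (fderiv ℝ f) z :=
    (hf.fderiv_right (m := (⊤ : ℕ∞)) (by simp)).differentiable (by simp) z
  have hsymm : fderiv ℝ (fderiv ℝ f) z 1 I = fderiv ℝ (fderiv ℝ f) z I 1 :=
    (hf.contDiffAt.isSymmSndFDerivAt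
      (by simpa using WithTop.coe_le_coe.2 (le_top (a := (2 : ℕ∞))))) 1 I
  have hD (v : ℂ) : HasFDerivAt (fun w => fderiv ℝ f w v)
      ((fderiv ℝ (fderiv ℝ f) z).flip v) z := by
    simpa using hd.hasFDerivAt.clm_apply (hasFDerivAt_const v z)
  have h1 : HasFDerivAt (wd f) _ z :=
    ((hD 1).sub ((hD I).const_mul I)).mul_const (2⁻¹ : ℂ)
  have h2 : HasFDerivAt (wdb f) _ z :=
    ((hD 1).add ((hD I).const_mul I)).mul_const (2⁻¹ : ℂ)
  rw [wdb, wd, h1.fderiv, h2.fderiv]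
  simp only [_root_.smul_apply, _root_.sub_apply,
    _root_.add_apply, ContinuousLinearMap.flip_apply, smul_eq_mul, hsymm]
  ring

/-- integrability condition for the tangential component of a
parametric Jacobi field. -/
theorem statement5 (u : ℂ → ℝ) (hu : ContDiff ℝ (⊤ : ℕ∞) u) (hsg : SinhGordon u)
    (r : ℝ) (om : ℂ → ℝ) (hom : ContDiff ℝ (⊤ : ℕ∞) om)
    (hJ : ∀ z, wdb (wd (cx om)) z + Complex.cosh (2 * (u z : ℂ)) * (om z : ℂ)
      = (r : ℂ) * Complex.exp (2 * (u z : ℂ))) :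
    ∀ z, wdb (fun w => wd (wd (cx om)) w - 2 * wd (cx u) w * wd (cx om) w) z
      = - wd (fun w => Complex.exp (-(2 * (u w : ℂ))) * (om w : ℂ)) z := by
  intro z
  have hU := contDiff_cx hu
  have hW := contDiff_cx hom
  have diff {f : ℂ → ℂ} (hf : ContDiff ℝ (⊤ : ℕ∞) f) : DifferentiableAt ℝ f z :=
    hf.differentiable (by simp) z
  have hexp (c : ℂ) : wd (fun w => exp (c * cx u w)) z =
      exp (c * cx u z) * c * wd (cx u) z := by
    refine wd_comp_of_hasDerivAt (h := fun x => exp (c * x)) ?_ (diff hU)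
    simpa using ((hasDerivAt_id (cx u z)).const_mul c).cexp
  have hcosh : wd (fun w => cosh (2 * cx u w)) z =
      sinh (2 * cx u z) * 2 * wd (cx u) z := by
    refine wd_comp_of_hasDerivAt (h := fun x => cosh (2 * x)) ?_ (diff hU)
    simpa using ((hasDerivAt_id (cx u z)).const_mul 2).ccosh
  have dexp (c : ℂ) : DifferentiableAt ℝ (fun w => exp (c * cx u w)) z :=
    diff (contDiff_const.mul hU).cexp
  have dcosh : DifferentiableAt ℝ (fun w => cosh (2 * cx u w)) z :=
    ((Complex.differentiable_cosh _).restrictScalars ℝ).comp z ((diff hU).const_mul 2)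
  have hJ' : wdb (wd (cx om)) =
      fun w => r * exp (2 * cx u w) - cosh (2 * cx u w) * cx om w :=
    funext fun w => eq_sub_of_add_eq (hJ w)
  have hsg' : wdb (wd (cx u)) z = -(1 / 2) * sinh (2 * cx u z) := by
    rw [wdb_wd_comm hU]
    linear_combination (norm := (simp only [cx]; ring)) hsg z
  have h3 : wdb (wd (wd (cx om))) z = r * (exp (2 * cx u z) * 2 * wd (cx u) z) -
      (sinh (2 * cx u z) * 2 * wd (cx u) z * cx om z + cosh (2 * cx u z) * wd (cx om) z) := by
    rw [wdb_wd_comm (contDiff_wd hW), hJ', wd_sub ((dexp 2).const_mul _) (dcosh.fun_mul (diff hW)),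
      wd_const_mul _ (dexp 2), wd_mul dcosh (diff hW), hexp, hcosh]
  have hrhs : wd (fun w => exp (-(2 * (u w : ℂ))) * (om w : ℂ)) z =
      exp (-2 * cx u z) * -2 * wd (cx u) z * cx om z + exp (-2 * cx u z) * wd (cx om) z := by
    rw [← hexp, ← wd_mul (dexp (-2)) (diff hW)]
    simp only [cx, neg_mul]
  have dU := diff (contDiff_wd hU)
  have dW := diff (contDiff_wd hW)
  rw [hrhs, wdb_sub (diff (contDiff_wd (contDiff_wd hW))) ((dU.const_mul 2).fun_mul dW),
    wdb_mul (dU.const_mul 2) dW, wdb_const_mul 2 dU, hsg', h3, hJ',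
    neg_mul 2 (cx u z), ← Complex.cosh_sub_sinh]
  ring
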